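/- Let ε ∈ {1, −1} and v = (e_1 + ε e_n)/√2 ∈ R^{p,q}. For z ∈ R^n with ε·q(z) > 0, define for all sufficiently large t > 0 (so that the denominator is nonzero) y_z(t) = (z + (t q(z)/2) v) / (1 + t⟨z,v⟩ + ε q(z) t²/4). Then for x, x' ∈ R^n with ε·q(x) > 0 and ε·q(x') > 0: lim_{t → +∞} t² (y_x(t) − y_{x'}(t)) = 4ε(x/q(x) − x'/q(x')) − 8(⟨x,v⟩/q(x) − ⟨x',v⟩/q(x'))·v, and this limit is nonzero whenever x ≠ x'. (This is the quantitative rate at which orbits of the space- or time-like translation flow approach each other, which identifies the holonomy sequence diag(t_k², …, t_k²).) -/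

import Mathlib

/-- The quadratic form `q` of signature `(p,q)` on `ℝ^n`, `n = p + q`. -/
noncomputable def qpq (p q : ℕ) (x : Fin (p + q) → ℝ) : ℝ :=
  2 * ∑ i : Fin p, x ⟨i, by omega⟩ * x ⟨p + q - 1 - i, by omega⟩
    + ∑ i : Fin (q - p), x ⟨p + i, by omega⟩ ^ 2

/-- The polarization `⟨·,·⟩` of `q`. -/
noncomputable def bpq (p q : ℕ) (x y : Fin (p + q) → ℝ) : ℝ :=
  ∑ i : Fin p,
      (x ⟨i, by omega⟩ * y ⟨p + q - 1 - i, by omega⟩ +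
        x ⟨p + q - 1 - i, by omega⟩ * y ⟨i, by omega⟩)
    + ∑ i : Fin (q - p), x ⟨p + i, by omega⟩ * y ⟨p + i, by omega⟩

/-- The `k`-th standard basis vector of `ℝ^n` (0-indexed). -/
noncomputable def stdb (p q : ℕ) (k : ℕ) : Fin (p + q) → ℝ :=
  fun j => if (j : ℕ) = k then 1 else 0

/-- The orbit `y_z(t) = (z + (tq(z)/2)v)/(1 + t⟨z,v⟩ + εq(z)t²/4)` of `j^o(z)`
under the translation flow, in the chart at infinity (defined for `t` large
enough that the denominator is nonzero). -/
noncomputable def orbit (p q : ℕ) (ε : ℝ) (v z : Fin (p + q) → ℝ) (t : ℝ) :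
    Fin (p + q) → ℝ :=
  (1 + t * bpq p q z v + ε * qpq p q z * t ^ 2 / 4)⁻¹ •
    (z + (t * qpq p q z / 2) • v)

open Filter Topology

theorem bpq_comm (p q : ℕ) (x y : Fin (p + q) → ℝ) : bpq p q x y = bpq p q y x := by
  unfold bpq
  congr 1
  · exact Finset.sum_congr rfl fun i _ => by ring
  · exact Finset.sum_congr rfl fun i _ => by ring

theorem bpq_add_left (p q : ℕ) (x y z : Fin (p + q) → ℝ) :
    bpq p q (x + y) z = bpq p q x z + bpq p q y z := by
  simp only [bpq, Pi.add_apply]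
  rw [add_add_add_comm, ← Finset.sum_add_distrib, ← Finset.sum_add_distrib]
  congr 1
  · exact Finset.sum_congr rfl fun i _ => by ring
  · exact Finset.sum_congr rfl fun i _ => by ring

theorem bpq_smul_left (p q : ℕ) (c : ℝ) (x z : Fin (p + q) → ℝ) :
    bpq p q (c • x) z = c * bpq p q x z := by
  simp only [bpq, Pi.smul_apply, smul_eq_mul]
  rw [mul_add, Finset.mul_sum, Finset.mul_sum]
  congr 1
  · exact Finset.sum_congr rfl fun i _ => by ring
  · exact Finset.sum_congr rfl fun i _ => by ring

theorem bpq_sub_left (p q : ℕ) (x y z : Fin (p + q) → ℝ) :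
    bpq p q (x - y) z = bpq p q x z - bpq p q y z := by
  rw [eq_sub_iff_add_eq, ← bpq_add_left, sub_add_cancel]

theorem bpq_smul_right (p q : ℕ) (c : ℝ) (x z : Fin (p + q) → ℝ) :
    bpq p q x (c • z) = c * bpq p q x z := by
  rw [bpq_comm, bpq_smul_left, bpq_comm]

theorem bpq_self (p q : ℕ) (x : Fin (p + q) → ℝ) : bpq p q x x = qpq p q x := by
  simp only [bpq, qpq]
  rw [Finset.mul_sum]
  congr 1
  · exact Finset.sum_congr rfl fun i _ => by ring
  · exact Finset.sum_congr rfl fun i _ => by ring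

theorem qpq_smul (p q : ℕ) (c : ℝ) (x : Fin (p + q) → ℝ) :
    qpq p q (c • x) = c ^ 2 * qpq p q x := by
  rw [← bpq_self, bpq_smul_left, bpq_smul_right, bpq_self]
  ring

theorem bpq_stdb_zero {p q : ℕ} (hp : 1 ≤ p) (hpq : p ≤ q) (z : Fin (p + q) → ℝ) :
    bpq p q (stdb p q 0) z = z ⟨p + q - 1, by omega⟩ := by
  unfold bpq stdb
  rw [Finset.sum_eq_single (⟨0, hp⟩ : Fin p), Finset.sum_eq_zero]
  · have : p + q - 1 ≠ 0 := by omega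
    simp [this]
  · intro i _
    have : p + (i : ℕ) ≠ 0 := by omega
    simp only [if_neg this, zero_mul]
  · intro i _ hi
    have h₁ : (i : ℕ) ≠ 0 := fun h => hi (Fin.ext h)
    have h₂ : p + q - 1 - (i : ℕ) ≠ 0 := by omega
    simp only [if_neg h₁, if_neg h₂, zero_mul, add_zero]
  · simp

theorem bpq_stdb_last {p q : ℕ} (hp : 1 ≤ p) (hpq : p ≤ q) (z : Fin (p + q) → ℝ) :
    bpq p q (stdb p q (p + q - 1)) z = z ⟨0, by omega⟩ := by
  unfold bpq stdb
  rw [Finset.sum_eq_single (⟨0, hp⟩ : Fin p), Finset.sum_eq_zero]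
  · have : 0 ≠ p + q - 1 := by omega
    simp [this]
  · intro i _
    have : p + (i : ℕ) ≠ p + q - 1 := by omega
    simp only [if_neg this, zero_mul]
  · intro i _ hi
    have h₀ : (i : ℕ) ≠ 0 := fun h => hi (Fin.ext h)
    have h₁ : (i : ℕ) ≠ p + q - 1 := by omega
    have h₂ : p + q - 1 - (i : ℕ) ≠ p + q - 1 := by omega
    simp only [if_neg h₁, if_neg h₂, zero_mul, add_zero]
  · simp

theorem bpq_translation_self {p q : ℕ} (hp : 1 ≤ p) (hpq : p ≤ q) (ε : ℝ) :
    bpq p q ((Real.sqrt 2)⁻¹ • (stdb p q 0 + ε • stdb p q (p + q - 1)))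
      ((Real.sqrt 2)⁻¹ • (stdb p q 0 + ε • stdb p q (p + q - 1))) = ε := by
  have h : p + q - 1 ≠ 0 := by omega
  have h2 : (Real.sqrt 2)⁻¹ * (Real.sqrt 2)⁻¹ = 2⁻¹ := by
    rw [← mul_inv, Real.mul_self_sqrt (by norm_num)]
  rw [bpq_smul_left, bpq_smul_right, bpq_add_left, bpq_smul_left, bpq_stdb_zero hp hpq,
    bpq_stdb_last hp hpq]
  simp only [stdb, Pi.add_apply, Pi.smul_apply, smul_eq_mul, h, h.symm, if_true, if_false]
  linear_combination 2 * ε * h2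

theorem tendsto_sq_mul_inv_quadratic (b : ℝ) {c : ℝ} (hc : c ≠ 0) :
    Tendsto (fun t : ℝ => t ^ 2 * (1 + t * b + c * t ^ 2)⁻¹) atTop (𝓝 c⁻¹) := by
  have hi : Tendsto (fun t : ℝ => t⁻¹) atTop (𝓝 0) := tendsto_inv_atTop_zero
  have h : Tendsto (fun t : ℝ => (t⁻¹ ^ 2 + t⁻¹ * b + c)⁻¹) atTop
      (𝓝 ((0 ^ 2 + 0 * b + c)⁻¹)) :=
    (((hi.pow 2).add (hi.mul_const b)).add_const c).inv₀ (by simpa using hc)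
  rw [show (0 ^ 2 + 0 * b + c : ℝ) = c by ring] at h
  refine h.congr' ?_
  filter_upwards [eventually_gt_atTop 0] with t ht
  have : 1 + t * b + c * t ^ 2 = t ^ 2 * (t⁻¹ ^ 2 + t⁻¹ * b + c) := by
    field_simp
  rw [this, mul_inv, mul_inv_cancel_left₀ (by positivity)]

theorem eventually_quadratic_ne_zero (b : ℝ) {c : ℝ} (hc : c ≠ 0) :
    ∀ᶠ t : ℝ in atTop, 1 + t * b + c * t ^ 2 ≠ 0 := by
  filter_upwards [(tendsto_sq_mul_inv_quadratic b hc).eventually_ne (inv_ne_zero hc)] with t ht h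
  simp [h] at ht

theorem tendsto_inv_mul_atTop_of_quadratic (b : ℝ) {c : ℝ} (hc : c ≠ 0) :
    Tendsto (fun t : ℝ => (1 + t * b + c * t ^ 2)⁻¹ * t) atTop (𝓝 0) := by
  have hi : Tendsto (fun t : ℝ => t⁻¹) atTop (𝓝 0) := tendsto_inv_atTop_zero
  have h := (tendsto_sq_mul_inv_quadratic b hc).mul hi
  rw [mul_zero] at h
  refine h.congr' ?_
  filter_upwards [eventually_gt_atTop 0] with t ht
  field_simp

/-- Two-term expansion of an orbit as `t → ∞`. -/
theorem tendsto_sq_smul_orbit_sub {p q : ℕ} {ε : ℝ} (hε : ε = 1 ∨ ε = -1)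
    (v z : Fin (p + q) → ℝ) (hz : qpq p q z ≠ 0) :
    Tendsto (fun t : ℝ => t ^ 2 • orbit p q ε v z t - (2 * ε * t) • v) atTop
      (𝓝 ((4 * ε * (qpq p q z)⁻¹) • z - (8 * (bpq p q z v / qpq p q z)) • v)) := by
  have hε2 : ε ^ 2 = 1 := by rcases hε with rfl | rfl <;> norm_num
  have hε0 : ε ≠ 0 := by rcases hε with rfl | rfl <;> norm_num
  unfold orbit
  generalize qpq p q z = Q at *
  generalize bpq p q z v = b
  have hc : ε * Q / 4 ≠ 0 := by positivity
  have h₁ := tendsto_sq_mul_inv_quadratic b hc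
  have h₂ := (tendsto_inv_mul_atTop_of_quadratic b hc).const_mul (2 * ε)
  have h₃ := ((h₁.smul_const z).sub ((h₂.add (h₁.const_mul (2 * ε * b))).smul_const v))
  have e₁ : (ε * Q / 4)⁻¹ = 4 * ε * Q⁻¹ := by
    field_simp
    linear_combination -hε2
  have e₂ : 2 * ε * 0 + 2 * ε * b * (4 * ε * Q⁻¹) = 8 * (b / Q) := by
    rw [div_eq_mul_inv]
    linear_combination 8 * b * Q⁻¹ * hε2
  rw [e₁, e₂] at h₃
  refine h₃.congr' ?_
  filter_upwards [eventually_quadratic_ne_zero b hc] with t ht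
  rw [show ε * Q * t ^ 2 / 4 = ε * Q / 4 * t ^ 2 by ring]
  generalize hD : 1 + t * b + ε * Q / 4 * t ^ 2 = D at *
  have hi : D⁻¹ * D = 1 := inv_mul_cancel₀ ht
  ext i
  simp only [Pi.sub_apply, Pi.smul_apply, Pi.add_apply, smul_eq_mul]
  linear_combination (-2 * ε * t * v i) * hi - (2 * ε * t * v i * D⁻¹) * hD
    + (D⁻¹ * t ^ 3 * Q * v i / 2) * hε2

/-- If `⟨v,v⟩ = ε = ±1`, the map `w ↦ 4εw - 8⟨w,v⟩v` (a multiple of the reflection in `v`)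
is injective. -/
theorem eq_zero_of_reflection_eq_zero {p q : ℕ} {ε : ℝ} (hε : ε = 1 ∨ ε = -1)
    {v w : Fin (p + q) → ℝ} (hv : bpq p q v v = ε)
    (h : (4 * ε) • w - (8 * bpq p q w v) • v = 0) : w = 0 := by
  have hε0 : 4 * ε ≠ 0 := by rcases hε with rfl | rfl <;> norm_num
  have h' := congrArg (fun u => bpq p q u v) h
  have h0 : bpq p q 0 v = 0 := by simpa using bpq_smul_left p q 0 0 v
  simp only [bpq_sub_left, bpq_smul_left, hv, h0] at h'
  have hw : bpq p q w v = 0 :=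
    (mul_eq_zero.mp (by linear_combination -h' : 4 * ε * bpq p q w v = 0)).resolve_left hε0
  rw [hw, mul_zero, zero_smul, sub_zero] at h
  exact (smul_eq_zero.mp h).resolve_left hε0

/-- The inversion `x ↦ x / q(x)` is injective off the light cone. -/
theorem eq_of_inversion_eq {p q : ℕ} {x y : Fin (p + q) → ℝ}
    (hx : qpq p q x ≠ 0) (hy : qpq p q y ≠ 0)
    (h : (qpq p q x)⁻¹ • x = (qpq p q y)⁻¹ • y) : x = y := by
  have hq := congrArg (qpq p q) h
  rw [qpq_smul, qpq_smul] at hq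
  have hq' : qpq p q x = qpq p q y := by
    field_simp at hq
    exact hq.symm
  rw [hq'] at h
  exact smul_right_injective _ (inv_ne_zero hy) h

/-- Rate at which orbits of the space- or time-like translation flow approach
each other: `t²(y_x(t) − y_{x'}(t))` converges as `t → ∞` to
`4ε(x/q(x) − x'/q(x')) − 8(⟨x,v⟩/q(x) − ⟨x',v⟩/q(x'))·v`, which is nonzero
whenever `x ≠ x'`. -/
theorem orbit_separation_rate (p q : ℕ) (hp : 1 ≤ p) (hpq : p ≤ q)
    (hn : 3 ≤ p + q) (ε : ℝ) (hε : ε = 1 ∨ ε = -1)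
    (v : Fin (p + q) → ℝ)
    (hv : v = (Real.sqrt 2)⁻¹ • (stdb p q 0 + ε • stdb p q (p + q - 1)))
    (x x' : Fin (p + q) → ℝ)
    (hqx : ε * qpq p q x > 0) (hqx' : ε * qpq p q x' > 0)
    (L : Fin (p + q) → ℝ)
    (hL : L = (4 * ε) • ((qpq p q x)⁻¹ • x - (qpq p q x')⁻¹ • x')
        - (8 * (bpq p q x v / qpq p q x - bpq p q x' v / qpq p q x')) • v) :
    Filter.Tendsto
        (fun t : ℝ => t ^ 2 • (orbit p q ε v x t - orbit p q ε v x' t))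
        Filter.atTop (nhds L)
    ∧ (x ≠ x' → L ≠ 0) := by
  have hx0 : qpq p q x ≠ 0 := right_ne_zero_of_mul hqx.ne'
  have hx0' : qpq p q x' ≠ 0 := right_ne_zero_of_mul hqx'.ne'
  have hvv : bpq p q v v = ε := hv ▸ bpq_translation_self hp hpq ε
  subst hL
  refine ⟨?_, fun hne h => hne ?_⟩
  · have h := (tendsto_sq_smul_orbit_sub hε v x hx0).sub
      (tendsto_sq_smul_orbit_sub hε v x' hx0')
    convert h using 2
    · module
    · module
  · refine eq_of_inversion_eq hx0 hx0' (sub_eq_zero.mp ?_)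
    refine eq_zero_of_reflection_eq_zero hε hvv ?_
    rw [bpq_sub_left, bpq_smul_left, bpq_smul_left, ← h]
    simp only [div_eq_inv_mul]
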